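/- Fix a finite POMDP with nonnegative rewards (r x a ≥ 0 for all x, a), k ≥ 1, a belief b₀, actions a₀, …, a_{k−1}, allowed observation sets Z̄₁, …, Z̄_k ⊆ Z, a horizon L ≥ 1, and the objects φ_j, X^R_j, C̄_k defined from them; assume (O x) z > 0 for every j ∈ {1, …, k}, every x ∈ X^R_j and every z ∈ Z̄_j. Suppose there is an action a* ∈ A such that for every action a' ≠ a*: C̄_k * Q^{OL} L φ_k a* ≥ (1 / C̄_k) * Q^{FO} L φ_k a' (the lower bound of a* exceeds the upper bound of every other action). Then for every observation sequence with z_j ∈ Z̄_j for all j, the resulting posterior belief b_k satisfies Q L b_k a* = max_{a ∈ A} Q L b_k a; i.e., a* is an optimal immediate action of the original POMDP at every such future belief, so replanning can be safely skipped. (Proposition 1, instantiated with the bounds of Theorem 5.) -/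

import Mathlib

open Finset

set_option maxHeartbeats 1000000

attribute [local instance] Classical.propDecidable

/-- A finite POMDP: transition kernel, observation kernel and reward. -/
structure POMDP (X A Z : Type) where
  T : X → A → PMF X
  O : X → PMF Z
  r : X → A → ℝ

namespace POMDP

variable {X A Z : Type} [Fintype X] [Fintype A] [Fintype Z]
variable [Nonempty X] [Nonempty A] [Nonempty Z]

/-- Real-valued transition probability. -/
noncomputable def Tr (M : POMDP X A Z) (x : X) (a : A) (x' : X) : ℝ :=
  ((M.T x a) x').toReal

/-- Real-valued observation probability. -/
noncomputable def Ob (M : POMDP X A Z) (x : X) (z : Z) : ℝ :=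
  ((M.O x) z).toReal

/-- A belief: nonnegative and sums to one. -/
def IsBelief (b : X → ℝ) : Prop :=
  (∀ x, 0 ≤ b x) ∧ ∑ x, b x = 1

/-- The propagated belief `b·a`. -/
noncomputable def prop (M : POMDP X A Z) (b : X → ℝ) (a : A) : X → ℝ :=
  fun x' => ∑ x, b x * M.Tr x a x'

/-- Expected reward `R(b,a)`. -/
noncomputable def Rew (M : POMDP X A Z) (b : X → ℝ) (a : A) : ℝ :=
  ∑ x, b x * M.r x a

/-- Observation likelihood `P(z ∣ b, a)`. -/
noncomputable def obsLik (M : POMDP X A Z) (z : Z) (b : X → ℝ) (a : A) : ℝ :=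
  ∑ x', M.prop b a x' * M.Ob x' z

/-- Bayes posterior `b^{a,z}`. -/
noncomputable def post (M : POMDP X A Z) (b : X → ℝ) (a : A) (z : Z) : X → ℝ :=
  fun x' => M.Ob x' z * M.prop b a x' / M.obsLik z b a

/-- Closed-loop optimal value `V`. -/
noncomputable def V (M : POMDP X A Z) : ℕ → (X → ℝ) → ℝ
  | 0, _ => 0
  | n + 1, b =>
    Finset.univ.sup' Finset.univ_nonempty fun a =>
      M.Rew b a +
        ∑ z ∈ Finset.univ.filter (fun z => 0 < M.obsLik z b a),
          M.obsLik z b a * V M n (M.post b a z)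

/-- Closed-loop optimal Q-function `Q`. -/
noncomputable def Q (M : POMDP X A Z) : ℕ → (X → ℝ) → A → ℝ
  | 0, _, _ => 0
  | n + 1, b, a =>
    M.Rew b a +
      ∑ z ∈ Finset.univ.filter (fun z => 0 < M.obsLik z b a),
        M.obsLik z b a * V M n (M.post b a z)

/-- Open-loop optimal value `W`. -/
noncomputable def W (M : POMDP X A Z) : ℕ → (X → ℝ) → ℝ
  | 0, _ => 0
  | n + 1, b =>
    Finset.univ.sup' Finset.univ_nonempty fun a =>
      M.Rew b a + W M n (M.prop b a)

/-- Open-loop Q-function `Q^{OL}`. -/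
noncomputable def QOL (M : POMDP X A Z) : ℕ → (X → ℝ) → A → ℝ
  | 0, _, _ => 0
  | n + 1, b, a => M.Rew b a + W M n (M.prop b a)

/-- Fully observable (MDP) optimal value `U`. -/
noncomputable def U (M : POMDP X A Z) : ℕ → X → ℝ
  | 0, _ => 0
  | n + 1, x =>
    Finset.univ.sup' Finset.univ_nonempty fun a =>
      M.r x a + ∑ x', M.Tr x a x' * U M n x'

/-- QMDP Q-function `Q^{FO}`. -/
noncomputable def QFO (M : POMDP X A Z) : ℕ → (X → ℝ) → A → ℝ
  | 0, _, _ => 0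
  | n + 1, b, a => M.Rew b a + ∑ x', M.prop b a x' * U M n x'

/-- Adaptive open-loop optimal value `V^{AOL}_β` on histories of actions and observations. -/
noncomputable def VAOL (M : POMDP X A Z) (β : List (A ⊕ Z) → Bool) :
    ℕ → (X → ℝ) → List (A ⊕ Z) → ℝ
  | 0, _, _ => 0
  | n + 1, b, h =>
    Finset.univ.sup' Finset.univ_nonempty fun a =>
      M.Rew b a +
        (if β h = true then VAOL M β n (M.prop b a) (h ++ [Sum.inl a])
        else
          ∑ z ∈ Finset.univ.filter (fun z => 0 < M.obsLik z b a),
            M.obsLik z b a * VAOL M β n (M.post b a z) (h ++ [Sum.inl a, Sum.inr z]))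

/-- Adaptive open-loop Q-function `Q^{AOL}_β`. -/
noncomputable def QAOL (M : POMDP X A Z) (β : List (A ⊕ Z) → Bool) :
    ℕ → (X → ℝ) → A → List (A ⊕ Z) → ℝ
  | 0, _, _, _ => 0
  | n + 1, b, a, h =>
    M.Rew b a +
      (if β h = true then VAOL M β n (M.prop b a) (h ++ [Sum.inl a])
      else
        ∑ z ∈ Finset.univ.filter (fun z => 0 < M.obsLik z b a),
          M.obsLik z b a * VAOL M β n (M.post b a z) (h ++ [Sum.inl a, Sum.inr z]))

/-- Point-mass belief at `x'`. -/
noncomputable def delta (x' : X) : X → ℝ := fun x => if x = x' then 1 else 0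

/-- Adaptive fully-observable optimal value `V^{AFO}_β` on histories of
actions, observations and states. -/
noncomputable def VAFO (M : POMDP X A Z) (β : List (A ⊕ (Z ⊕ X)) → Bool) :
    ℕ → (X → ℝ) → List (A ⊕ (Z ⊕ X)) → ℝ
  | 0, _, _ => 0
  | n + 1, b, h =>
    Finset.univ.sup' Finset.univ_nonempty fun a =>
      M.Rew b a +
        (if β h = true then
          ∑ x', M.prop b a x' *
            VAFO M β n (delta x') (h ++ [Sum.inl a, Sum.inr (Sum.inr x')])
        else
          ∑ z ∈ Finset.univ.filter (fun z => 0 < M.obsLik z b a),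
            M.obsLik z b a *
              VAFO M β n (M.post b a z) (h ++ [Sum.inl a, Sum.inr (Sum.inl z)]))

/-- Adaptive fully-observable Q-function `Q^{AFO}_β`. -/
noncomputable def QAFO (M : POMDP X A Z) (β : List (A ⊕ (Z ⊕ X)) → Bool) :
    ℕ → (X → ℝ) → A → List (A ⊕ (Z ⊕ X)) → ℝ
  | 0, _, _, _ => 0
  | n + 1, b, a, h =>
    M.Rew b a +
      (if β h = true then
        ∑ x', M.prop b a x' *
          VAFO M β n (delta x') (h ++ [Sum.inl a, Sum.inr (Sum.inr x')])
      else
        ∑ z ∈ Finset.univ.filter (fun z => 0 < M.obsLik z b a),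
          M.obsLik z b a *
            VAFO M β n (M.post b a z) (h ++ [Sum.inl a, Sum.inr (Sum.inl z)]))

/-- Depth-indexed adaptive open-loop value. -/
noncomputable def VAOLd (M : POMDP X A Z) (β : ℕ → Bool) : ℕ → ℕ → (X → ℝ) → ℝ
  | _, 0, _ => 0
  | d, n + 1, b =>
    Finset.univ.sup' Finset.univ_nonempty fun a =>
      M.Rew b a +
        (if β d = true then VAOLd M β (d + 1) n (M.prop b a)
        else
          ∑ z ∈ Finset.univ.filter (fun z => 0 < M.obsLik z b a),
            M.obsLik z b a * VAOLd M β (d + 1) n (M.post b a z))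

/-- Depth-indexed adaptive fully-observable value. -/
noncomputable def VAFOd (M : POMDP X A Z) (β : ℕ → Bool) : ℕ → ℕ → (X → ℝ) → ℝ
  | _, 0, _ => 0
  | d, n + 1, b =>
    Finset.univ.sup' Finset.univ_nonempty fun a =>
      M.Rew b a +
        (if β d = true then
          ∑ x', M.prop b a x' * VAFOd M β (d + 1) n (delta x')
        else
          ∑ z ∈ Finset.univ.filter (fun z => 0 < M.obsLik z b a),
            M.obsLik z b a * VAFOd M β (d + 1) n (M.post b a z))

/-- Open-loop propagated beliefs `φ₀ = b`, `φ_{i+1} = φ_i · a i` along a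
finite action sequence. -/
noncomputable def propFin (M : POMDP X A Z) (b : X → ℝ) {n : ℕ} (a : Fin n → A)
    (j : Fin (n + 1)) : X → ℝ :=
  Fin.induction b (fun i ih => M.prop ih (a i)) j

end POMDP

namespace POMDP

section helpers

variable {X A Z : Type} [Fintype X] [Fintype A] [Fintype Z]
variable [Nonempty X] [Nonempty A] [Nonempty Z]

theorem Tr_nonneg (M : POMDP X A Z) (x : X) (a : A) (x' : X) : 0 ≤ M.Tr x a x' :=
  ENNReal.toReal_nonneg

theorem Ob_nonneg (M : POMDP X A Z) (x : X) (z : Z) : 0 ≤ M.Ob x z :=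
  ENNReal.toReal_nonneg

theorem pmf_sum {α : Type} [Fintype α] (p : PMF α) : ∑ x, (p x).toReal = 1 := by
  rw [← ENNReal.toReal_sum (fun x _ => p.apply_ne_top x), ← tsum_fintype (L := .unconditional _), p.tsum_coe]
  simp

theorem Tr_sum (M : POMDP X A Z) (x : X) (a : A) : ∑ x', M.Tr x a x' = 1 := pmf_sum _

theorem Ob_sum (M : POMDP X A Z) (x : X) : ∑ z, M.Ob x z = 1 := pmf_sum _

theorem prop_nonneg (M : POMDP X A Z) (b : X → ℝ) (hb : ∀ x, 0 ≤ b x) (a : A) (x : X) :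
    0 ≤ M.prop b a x :=
  Finset.sum_nonneg fun y _ => mul_nonneg (hb y) (M.Tr_nonneg _ _ _)

theorem prop_belief (M : POMDP X A Z) (b : X → ℝ) (hb : IsBelief b) (a : A) :
    IsBelief (M.prop b a) := by
  refine ⟨M.prop_nonneg b hb.1 a, ?_⟩
  unfold prop
  rw [Finset.sum_comm]
  simp only [← Finset.mul_sum, Tr_sum, mul_one]
  exact hb.2

theorem prop_mono (M : POMDP X A Z) (b b' : X → ℝ) (c : ℝ) (h : ∀ x, c * b x ≤ b' x) (a : A)
    (x : X) : c * M.prop b a x ≤ M.prop b' a x := by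
  unfold prop
  rw [Finset.mul_sum]
  refine Finset.sum_le_sum fun y _ => ?_
  rw [← mul_assoc]
  exact mul_le_mul_of_nonneg_right (h y) (M.Tr_nonneg _ _ _)

theorem obsLik_nonneg (M : POMDP X A Z) (b : X → ℝ) (hb : ∀ x, 0 ≤ b x) (a : A) (z : Z) :
    0 ≤ M.obsLik z b a :=
  Finset.sum_nonneg fun y _ => mul_nonneg (M.prop_nonneg b hb a y) (M.Ob_nonneg _ _)

theorem post_nonneg (M : POMDP X A Z) (b : X → ℝ) (hb : ∀ x, 0 ≤ b x) (a : A) (z : Z) (x : X) :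
    0 ≤ M.post b a z x :=
  div_nonneg (mul_nonneg (M.Ob_nonneg _ _) (M.prop_nonneg b hb a x)) (M.obsLik_nonneg b hb a z)

theorem sum_post (M : POMDP X A Z) (b : X → ℝ) (hb : ∀ x, 0 ≤ b x) (a : A) (x : X) :
    ∑ z ∈ Finset.univ.filter (fun z => 0 < M.obsLik z b a),
      M.obsLik z b a * M.post b a z x = M.prop b a x := by
  rw [Finset.sum_filter]
  have : ∀ z, (if 0 < M.obsLik z b a then M.obsLik z b a * M.post b a z x else 0)
      = M.prop b a x * M.Ob x z := by
    intro z
    split_ifs with h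
    · unfold post
      field_simp
    · have h0 : M.obsLik z b a = 0 := le_antisymm (not_lt.mp h) (M.obsLik_nonneg b hb a z)
      unfold obsLik at h0
      rw [Finset.sum_eq_zero_iff_of_nonneg
        (fun y _ => mul_nonneg (M.prop_nonneg b hb a y) (M.Ob_nonneg _ _))] at h0
      exact (h0 x (Finset.mem_univ x)).symm
  simp only [this]
  rw [← Finset.mul_sum, Ob_sum, mul_one]

theorem Rew_mono (M : POMDP X A Z) (hr : ∀ (x : X) (a : A), 0 ≤ M.r x a)
    (b b' : X → ℝ) (c : ℝ) (h : ∀ x, c * b x ≤ b' x) (a : A) :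
    c * M.Rew b a ≤ M.Rew b' a := by
  unfold Rew
  rw [Finset.mul_sum]
  refine Finset.sum_le_sum fun y _ => ?_
  rw [← mul_assoc]
  exact mul_le_mul_of_nonneg_right (h y) (hr _ _)

theorem W_mono (M : POMDP X A Z) (hr : ∀ (x : X) (a : A), 0 ≤ M.r x a) (c : ℝ) (n : ℕ) :
    ∀ (b b' : X → ℝ), (∀ x, c * b x ≤ b' x) → c * M.W n b ≤ M.W n b' := by
  induction n with
  | zero => intro b b' _; simp [W]
  | succ n ih =>
    intro b b' h
    obtain ⟨a, _, ha⟩ := Finset.exists_mem_eq_sup' (Finset.univ_nonempty (α := A))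
      (fun a => M.Rew b a + M.W n (M.prop b a))
    simp only [W]
    rw [ha]
    refine le_trans ?_ (Finset.le_sup' (fun a => M.Rew b' a + M.W n (M.prop b' a))
      (Finset.mem_univ a))
    have h1 := M.Rew_mono hr b b' c h a
    have h2 := ih _ _ (M.prop_mono b b' c h a)
    linarith

theorem QOL_mono (M : POMDP X A Z) (hr : ∀ (x : X) (a : A), 0 ≤ M.r x a) (c : ℝ) (n : ℕ)
    (b b' : X → ℝ) (h : ∀ x, c * b x ≤ b' x) (a : A) : c * M.QOL n b a ≤ M.QOL n b' a := by
  cases n with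
  | zero => simp [QOL]
  | succ n =>
    have h1 := M.Rew_mono hr b b' c h a
    have h2 := M.W_mono hr c n _ _ (M.prop_mono b b' c h a)
    simp only [QOL]
    linarith

theorem U_nonneg (M : POMDP X A Z) (hr : ∀ (x : X) (a : A), 0 ≤ M.r x a) (n : ℕ) :
    ∀ x, 0 ≤ M.U n x := by
  induction n with
  | zero => intro x; simp [U]
  | succ n ih =>
    intro x
    obtain ⟨a⟩ := (inferInstance : Nonempty A)
    simp only [U]
    refine le_trans ?_ (Finset.le_sup' (fun a => M.r x a + ∑ x', M.Tr x a x' * M.U n x')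
      (Finset.mem_univ a))
    exact add_nonneg (hr _ _) (Finset.sum_nonneg fun y _ => mul_nonneg (M.Tr_nonneg _ _ _) (ih y))

theorem QFO_mono (M : POMDP X A Z) (hr : ∀ (x : X) (a : A), 0 ≤ M.r x a) (c : ℝ) (n : ℕ)
    (b b' : X → ℝ) (h : ∀ x, c * b x ≤ b' x) (a : A) : c * M.QFO n b a ≤ M.QFO n b' a := by
  cases n with
  | zero => simp [QFO]
  | succ n =>
    have h1 := M.Rew_mono hr b b' c h a
    have h2 : c * ∑ x', M.prop b a x' * M.U n x' ≤ ∑ x', M.prop b' a x' * M.U n x' := by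
      rw [Finset.mul_sum]
      refine Finset.sum_le_sum fun y _ => ?_
      rw [← mul_assoc]
      exact mul_le_mul_of_nonneg_right (M.prop_mono b b' c h a y) (M.U_nonneg hr n y)
    simp only [QFO]
    linarith

theorem Rew_sum (M : POMDP X A Z) {ι : Type} (s : Finset ι) (w : ι → ℝ) (f : ι → X → ℝ) (a : A) :
    M.Rew (fun x => ∑ i ∈ s, w i * f i x) a = ∑ i ∈ s, w i * M.Rew (f i) a := by
  simp only [Rew, Finset.sum_mul, Finset.mul_sum]
  rw [Finset.sum_comm]
  simp only [mul_assoc]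

theorem prop_sum (M : POMDP X A Z) {ι : Type} (s : Finset ι) (w : ι → ℝ) (f : ι → X → ℝ) (a : A) :
    M.prop (fun x => ∑ i ∈ s, w i * f i x) a = fun x => ∑ i ∈ s, w i * M.prop (f i) a x := by
  funext x
  simp only [prop, Finset.sum_mul, Finset.mul_sum]
  rw [Finset.sum_comm]
  simp only [mul_assoc]

theorem W_convex (M : POMDP X A Z) {ι : Type} (s : Finset ι) (w : ι → ℝ)
    (hw : ∀ i ∈ s, 0 ≤ w i) (n : ℕ) : ∀ (f : ι → X → ℝ),
    M.W n (fun x => ∑ i ∈ s, w i * f i x) ≤ ∑ i ∈ s, w i * M.W n (f i) := by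
  induction n with
  | zero => intro f; simp [W]
  | succ n ih =>
    intro f
    simp only [W]
    refine Finset.sup'_le _ _ fun a _ => ?_
    rw [Rew_sum, prop_sum]
    refine le_trans (add_le_add le_rfl (ih _)) ?_
    rw [← Finset.sum_add_distrib]
    refine Finset.sum_le_sum fun i hi => ?_
    rw [← mul_add]
    exact mul_le_mul_of_nonneg_left
      (Finset.le_sup' (fun a => M.Rew (f i) a + M.W n (M.prop (f i) a)) (Finset.mem_univ a))
      (hw i hi)

theorem W_prop_le (M : POMDP X A Z) (n : ℕ) (b : X → ℝ) (hb : ∀ x, 0 ≤ b x) (a : A) :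
    M.W n (M.prop b a) ≤ ∑ z ∈ Finset.univ.filter (fun z => 0 < M.obsLik z b a),
      M.obsLik z b a * M.W n (M.post b a z) := by
  have h := M.W_convex (Finset.univ.filter (fun z => 0 < M.obsLik z b a))
    (fun z => M.obsLik z b a) (fun z _ => M.obsLik_nonneg b hb a z) n (fun z => M.post b a z)
  have e : (fun x => ∑ z ∈ Finset.univ.filter (fun z => 0 < M.obsLik z b a),
      M.obsLik z b a * M.post b a z x) = M.prop b a := funext (M.sum_post b hb a)
  rw [e] at h
  exact h

theorem W_le_V (M : POMDP X A Z) (n : ℕ) : ∀ (b : X → ℝ), (∀ x, 0 ≤ b x) →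
    M.W n b ≤ M.V n b := by
  induction n with
  | zero => intro b _; simp [W, V]
  | succ n ih =>
    intro b hb
    simp only [W, V]
    refine Finset.sup'_mono_fun fun a _ => ?_
    refine add_le_add le_rfl ((M.W_prop_le n b hb a).trans ?_)
    exact Finset.sum_le_sum fun z _ => mul_le_mul_of_nonneg_left
      (ih _ (M.post_nonneg b hb a z)) (M.obsLik_nonneg b hb a z)

theorem QOL_le_Q (M : POMDP X A Z) (n : ℕ) (b : X → ℝ) (hb : ∀ x, 0 ≤ b x) (a : A) :
    M.QOL n b a ≤ M.Q n b a := by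
  cases n with
  | zero => simp [QOL, Q]
  | succ n =>
    simp only [QOL, Q]
    refine add_le_add le_rfl ((M.W_prop_le n b hb a).trans ?_)
    exact Finset.sum_le_sum fun z _ => mul_le_mul_of_nonneg_left
      (M.W_le_V n _ (M.post_nonneg b hb a z)) (M.obsLik_nonneg b hb a z)

theorem sum_post_U (M : POMDP X A Z) (u : X → ℝ) (b : X → ℝ) (hb : ∀ x, 0 ≤ b x) (a : A) :
    ∑ z ∈ Finset.univ.filter (fun z => 0 < M.obsLik z b a),
      M.obsLik z b a * ∑ x, M.post b a z x * u x = ∑ x, M.prop b a x * u x := by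
  simp only [Finset.mul_sum]
  rw [Finset.sum_comm]
  refine Finset.sum_congr rfl fun x _ => ?_
  rw [← M.sum_post b hb a x, Finset.sum_mul]
  simp only [mul_assoc]

theorem V_le_U (M : POMDP X A Z) (n : ℕ) : ∀ (b : X → ℝ), (∀ x, 0 ≤ b x) →
    M.V n b ≤ ∑ x, b x * M.U n x := by
  induction n with
  | zero => intro b _; simp [U, V]
  | succ n ih =>
    intro b hb
    simp only [V]
    refine Finset.sup'_le _ _ fun a _ => ?_
    have h1 : ∑ z ∈ Finset.univ.filter (fun z => 0 < M.obsLik z b a),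
        M.obsLik z b a * M.V n (M.post b a z) ≤ ∑ x, M.prop b a x * M.U n x := by
      rw [← M.sum_post_U _ b hb a]
      exact Finset.sum_le_sum fun z _ => mul_le_mul_of_nonneg_left
        (ih _ (M.post_nonneg b hb a z)) (M.obsLik_nonneg b hb a z)
    refine (add_le_add le_rfl h1).trans ?_
    have h2 : ∑ x, M.prop b a x * M.U n x = ∑ x, b x * ∑ x', M.Tr x a x' * M.U n x' := by
      simp only [prop, Finset.sum_mul, Finset.mul_sum]
      rw [Finset.sum_comm]
      simp only [mul_assoc]
    rw [h2, Rew, ← Finset.sum_add_distrib]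
    refine Finset.sum_le_sum fun x _ => ?_
    rw [← mul_add]
    refine mul_le_mul_of_nonneg_left ?_ (hb x)
    simp only [U]
    exact Finset.le_sup' (fun a => M.r x a + ∑ x', M.Tr x a x' * M.U n x') (Finset.mem_univ a)

theorem Q_le_QFO (M : POMDP X A Z) (n : ℕ) (b : X → ℝ) (hb : ∀ x, 0 ≤ b x) (a : A) :
    M.Q n b a ≤ M.QFO n b a := by
  cases n with
  | zero => simp [QFO, Q]
  | succ n =>
    simp only [QFO, Q]
    refine add_le_add le_rfl ?_
    rw [← M.sum_post_U _ b hb a]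
    exact Finset.sum_le_sum fun z _ => mul_le_mul_of_nonneg_left
      (M.V_le_U n _ (M.post_nonneg b hb a z)) (M.obsLik_nonneg b hb a z)

/-- One Bayes step: the posterior stays within the bounds. -/
theorem post_step (M : POMDP X A Z) (b f : X → ℝ) (hb : IsBelief b) (a : A) (z : Z)
    (c m mx : ℝ) (hc : 0 < c) (hm : 0 < m)
    (hO : ∀ x, 0 < M.prop f a x → m ≤ M.Ob x z ∧ M.Ob x z ≤ mx)
    (h1 : ∀ x, c * f x ≤ b x) (h2 : ∀ x, c * b x ≤ f x) :
    IsBelief (M.post b a z) ∧ (∀ x, (c * (m / mx)) * M.prop f a x ≤ M.post b a z x) ∧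
      (∀ x, (c * (m / mx)) * M.post b a z x ≤ M.prop f a x) := by
  have hp := M.prop_belief b hb a
  have g1 := M.prop_mono f b c h1 a
  have g2 := M.prop_mono b f c h2 a
  have hO' : ∀ x, 0 < M.prop b a x → m ≤ M.Ob x z ∧ M.Ob x z ≤ mx := fun x hx =>
    hO x (lt_of_lt_of_le (mul_pos hc hx) (g2 x))
  have hlo : m ≤ M.obsLik z b a := by
    have : m = ∑ x, M.prop b a x * m := by rw [← Finset.sum_mul, hp.2, one_mul]
    rw [this]
    refine Finset.sum_le_sum fun x _ => ?_
    rcases (hp.1 x).eq_or_lt with h | h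
    · rw [← h]; simp
    · exact mul_le_mul_of_nonneg_left (hO' x h).1 h.le
  have hhi : M.obsLik z b a ≤ mx := by
    have : mx = ∑ x, M.prop b a x * mx := by rw [← Finset.sum_mul, hp.2, one_mul]
    rw [this]
    refine Finset.sum_le_sum fun x _ => ?_
    rcases (hp.1 x).eq_or_lt with h | h
    · rw [← h]; simp
    · exact mul_le_mul_of_nonneg_left (hO' x h).2 h.le
  have hP : 0 < M.obsLik z b a := hm.trans_le hlo
  have hmx : 0 < mx := hP.trans_le hhi
  refine ⟨⟨M.post_nonneg b hb.1 a z, ?_⟩, fun x => ?_, fun x => ?_⟩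
  · unfold post
    rw [← Finset.sum_div, div_eq_one_iff_eq hP.ne', obsLik]
    exact Finset.sum_congr rfl fun x _ => mul_comm _ _
  · rcases (hp.1 x).eq_or_lt with h | h
    · have hf : c * M.prop f a x ≤ 0 := by rw [h]; exact g1 x
      refine le_trans ?_ (M.post_nonneg b hb.1 a z x)
      have : (c * (m / mx)) * M.prop f a x = (m / mx) * (c * M.prop f a x) := by ring
      rw [this]
      exact mul_nonpos_of_nonneg_of_nonpos (div_pos hm hmx).le hf
    · have e1 : (c * (m / mx)) * M.prop f a x = (m / mx) * (c * M.prop f a x) := by ring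
      have e2 : M.post b a z x = (M.Ob x z / M.obsLik z b a) * M.prop b a x := by
        unfold post; ring
      rw [e1, e2]
      refine (mul_le_mul_of_nonneg_left (g1 x) (div_pos hm hmx).le).trans ?_
      refine mul_le_mul_of_nonneg_right ?_ h.le
      exact div_le_div₀ (M.Ob_nonneg _ _) (hO' x h).1 hP hhi
  · refine le_trans ?_ (g2 x)
    have e2 : (c * (m / mx)) * M.post b a z x =
        c * (((m / mx) * (M.Ob x z / M.obsLik z b a)) * M.prop b a x) := by
      unfold post; ring
    rw [e2]
    refine mul_le_mul_of_nonneg_left ?_ hc.le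
    rcases (hp.1 x).eq_or_lt with h | h
    · rw [← h]; simp
    · refine mul_le_of_le_one_left h.le ?_
      rw [div_mul_div_comm, div_le_one (mul_pos hmx hP), mul_comm mx]
      exact mul_le_mul hlo (hO' x h).2 (M.Ob_nonneg _ _) hP.le

theorem chain (M : POMDP X A Z) (b₀ : X → ℝ) (hb₀ : IsBelief b₀) : ∀ (k : ℕ) (a : Fin k → A)
    (z : Fin k → Z) (m mx : Fin k → ℝ) (φ bp : Fin (k + 1) → X → ℝ),
    φ 0 = b₀ → (∀ j : Fin k, φ j.succ = M.prop (φ j.castSucc) (a j)) →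
    bp 0 = b₀ → (∀ j : Fin k, bp j.succ = M.post (bp j.castSucc) (a j) (z j)) →
    (∀ j, 0 < m j) → (∀ j, 0 < mx j) →
    (∀ j : Fin k, ∀ x, 0 < φ j.succ x → m j ≤ M.Ob x (z j) ∧ M.Ob x (z j) ≤ mx j) →
    IsBelief (bp (Fin.last k)) ∧
      (∀ x, (∏ j, m j / mx j) * φ (Fin.last k) x ≤ bp (Fin.last k) x) ∧
      (∀ x, (∏ j, m j / mx j) * bp (Fin.last k) x ≤ φ (Fin.last k) x) := by
  intro k
  induction k with
  | zero =>
    intro a z m mx φ bp h0 _ h0' _ _ _ _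
    have e : Fin.last 0 = 0 := rfl
    rw [e, h0, h0']
    simp [hb₀]
  | succ k ih =>
    intro a z m mx φ bp h0 hφ h0' hbp hm hmx hO
    obtain ⟨i1, i2, i3⟩ := ih (fun j => a j.castSucc) (fun j => z j.castSucc)
      (fun j => m j.castSucc) (fun j => mx j.castSucc) (fun j => φ j.castSucc)
      (fun j => bp j.castSucc) h0 (fun j => hφ j.castSucc) h0' (fun j => hbp j.castSucc)
      (fun j => hm _) (fun j => hmx _) (fun j => hO j.castSucc)
    have hl : Fin.last (k + 1) = (Fin.last k).succ := rfl
    rw [hl, hφ, hbp, Fin.prod_univ_castSucc]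
    refine M.post_step _ _ i1 _ _ _ _ _ (Finset.prod_pos fun j _ => div_pos (hm _) (hmx _))
      (hm _) ?_ i2 i3
    intro x hx
    rw [← hφ] at hx
    exact hO _ x hx

end helpers

end POMDP

/-- Proposition 1 instantiated with the bounds of
Theorem 5: if the `C̄_k`-lower bound of some action `a*` dominates the
`(1/C̄_k)`-upper bound of every other action, then for every observation
sequence with `z_j ∈ Z̄_j` the action `a*` is an optimal immediate action of
the original POMDP at the resulting posterior belief, so replanning can be
safely skipped. -/
theorem safe_skip_replanning {X A Z : Type}
    [Fintype X] [Fintype A] [Fintype Z]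
    [Nonempty X] [Nonempty A] [Nonempty Z]
    (M : POMDP X A Z) (hr : ∀ (x : X) (a : A), 0 ≤ M.r x a)
    (k : ℕ) (hk : 1 ≤ k)
    (b₀ : X → ℝ) (hb₀ : POMDP.IsBelief b₀)
    (a : Fin k → A) (Zbar : Fin k → Set Z)
    (φ : Fin (k + 1) → X → ℝ)
    (hφ0 : φ 0 = b₀)
    (hφ : ∀ j : Fin k, φ j.succ = M.prop (φ j.castSucc) (a j))
    (hobs : ∀ j : Fin k, ∀ x : X, 0 < φ j.succ x → ∀ z ∈ Zbar j, 0 < M.Ob x z)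
    (L : ℕ) (hL : 1 ≤ L)
    (astar : A)
    (hsep : ∀ a' : A, a' ≠ astar →
      (1 /
          ∏ j : Fin k,
            sInf (Set.image2 M.Ob {x | 0 < φ j.succ x} (Zbar j)) /
              sSup (Set.image2 M.Ob {x | 0 < φ j.succ x} (Zbar j))) *
          M.QFO L (φ (Fin.last k)) a' ≤
        (∏ j : Fin k,
            sInf (Set.image2 M.Ob {x | 0 < φ j.succ x} (Zbar j)) /
              sSup (Set.image2 M.Ob {x | 0 < φ j.succ x} (Zbar j))) *
          M.QOL L (φ (Fin.last k)) astar) :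
    ∀ (z : Fin k → Z), (∀ j : Fin k, z j ∈ Zbar j) →
      ∀ bp : Fin (k + 1) → X → ℝ,
        bp 0 = b₀ →
        (∀ j : Fin k, bp j.succ = M.post (bp j.castSucc) (a j) (z j)) →
        M.Q L (bp (Fin.last k)) astar =
          Finset.univ.sup' Finset.univ_nonempty
            (fun a' : A => M.Q L (bp (Fin.last k)) a') := by
  intro z hz bp hbp0 hbp
  have hφb : ∀ j, POMDP.IsBelief (φ j) := by
    intro j
    induction j using Fin.induction with
    | zero => rw [hφ0]; exact hb₀
    | succ j ih => rw [hφ]; exact M.prop_belief _ ih _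
  have hne : ∀ j, ∃ x, 0 < φ j x := by
    intro j
    by_contra hcon
    push Not at hcon
    have h1 := (hφb j).2
    have h2 : ∑ x, φ j x ≤ 0 := Finset.sum_nonpos fun x _ => hcon x
    linarith
  have hfin : ∀ j : Fin k, (Set.image2 M.Ob {x | 0 < φ j.succ x} (Zbar j)).Finite := fun j =>
    Set.Finite.image2 _ (Set.toFinite _) (Set.toFinite _)
  have hnon : ∀ j : Fin k, (Set.image2 M.Ob {x | 0 < φ j.succ x} (Zbar j)).Nonempty := by
    intro j
    obtain ⟨x, hx⟩ := hne j.succ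
    exact ⟨_, Set.mem_image2_of_mem hx (hz j)⟩
  have hmem : ∀ j : Fin k, ∀ x, 0 < φ j.succ x →
      M.Ob x (z j) ∈ Set.image2 M.Ob {x | 0 < φ j.succ x} (Zbar j) := fun j x hx =>
    Set.mem_image2_of_mem hx (hz j)
  have hpos : ∀ j : Fin k, ∀ v ∈ Set.image2 M.Ob {x | 0 < φ j.succ x} (Zbar j), 0 < v := by
    rintro j v ⟨x, hx, y, hy, rfl⟩
    exact hobs j x hx y hy
  have hm : ∀ j : Fin k, 0 < sInf (Set.image2 M.Ob {x | 0 < φ j.succ x} (Zbar j)) := fun j =>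
    hpos j _ ((hnon j).csInf_mem (hfin j))
  have hmx : ∀ j : Fin k, 0 < sSup (Set.image2 M.Ob {x | 0 < φ j.succ x} (Zbar j)) := fun j =>
    hpos j _ ((hnon j).csSup_mem (hfin j))
  obtain ⟨c1, c2, c3⟩ := M.chain b₀ hb₀ k a z _ _ φ bp hφ0 hφ hbp0 hbp hm hmx
    (fun j x hx => ⟨csInf_le (hfin j).bddBelow (hmem j x hx),
      le_csSup (hfin j).bddAbove (hmem j x hx)⟩)
  have hC := Finset.prod_pos (s := Finset.univ) fun (j : Fin k) _ => div_pos (hm j) (hmx j)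
  refine le_antisymm (Finset.le_sup' (fun a' : A => M.Q L (bp (Fin.last k)) a')
    (Finset.mem_univ astar)) (Finset.sup'_le _ _ fun a' _ => ?_)
  by_cases h : a' = astar
  · rw [h]
  · have s1 := M.Q_le_QFO L _ c1.1 a'
    have s2 := M.QFO_mono hr _ L _ _ c3 a'
    have s3 := hsep a' h
    have s4 := M.QOL_mono hr _ L _ _ c2 astar
    have s5 := M.QOL_le_Q L _ c1.1 astar
    rw [mul_comm, ← le_div_iff₀ hC] at s2
    rw [one_div_mul_eq_div] at s3
    linarith
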